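/- arXiv:2509.16234 — 3 statements merged into one kernel-verified Lean document; each statement's English description precedes it below -/
import Mathlib

section
/- Let p be a prime, n ≥ 1, f ∈ ℤ[X], let v ∈ ZMod p^n be a periodic point of F_{p^n} of minimal period k, and let w ∈ ZMod p^{n+1} be a lift of v that is a periodic point of F_{p^{n+1}} of minimal period k·M for some integer M ≥ 1. Then λ̄(w) = λ̄(v)^M in ZMod p; moreover, if M > 1 then λ̄(w) = 1. -/
/-- The map on `ZMod m` induced by a polynomial `f ∈ ℤ[X]`. -/
noncomputable def polyMap (m : ℕ) (f : Polynomial ℤ) : ZMod m → ZMod m :=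
  fun x => Polynomial.aeval x f

/-- The multiplier `λ(v) = ∏_{i=0}^{k-1} f'(F_m^i(v)) ∈ ZMod m` of a periodic point `v`
of minimal period `k`. -/
noncomputable def multiplier (m : ℕ) (f : Polynomial ℤ) (k : ℕ) (v : ZMod m) : ZMod m :=
  ∏ i ∈ Finset.range k, Polynomial.aeval ((polyMap m f)^[i] v) (Polynomial.derivative f)

open Polynomial in
theorem map_aeval_int {R S : Type*} [CommRing R] [CommRing S] (φ : R →+* S) (f : ℤ[X]) (x : R) :
    φ (aeval x f) = aeval (φ x) f := by
  simpa using (aeval_algHom_apply φ.toIntAlgHom x f).symm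

theorem semiconj_polyMap {a b : ℕ} (φ : ZMod a →+* ZMod b) (f : Polynomial ℤ) :
    Function.Semiconj φ (polyMap a f) (polyMap b f) :=
  fun x => map_aeval_int φ f x

theorem map_multiplier {a b : ℕ} (φ : ZMod a →+* ZMod b) (f : Polynomial ℤ) (k : ℕ) (x : ZMod a) :
    φ (multiplier a f k x) = multiplier b f k (φ x) := by
  simp only [multiplier, map_prod, map_aeval_int]
  exact Finset.prod_congr rfl fun i _ => by rw [((semiconj_polyMap φ f).iterate_right i).eq]

theorem multiplier_add (m : ℕ) (f : Polynomial ℤ) (k l : ℕ) (x : ZMod m) :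
    multiplier m f (k + l) x = multiplier m f k x * multiplier m f l ((polyMap m f)^[k] x) := by
  simp only [multiplier, Finset.prod_range_add, ← Function.iterate_add_apply, Nat.add_comm _ k]

theorem multiplier_mul_of_isPeriodicPt {m : ℕ} {f : Polynomial ℤ} {k : ℕ} {x : ZMod m}
    (h : Function.IsPeriodicPt (polyMap m f) k x) (M : ℕ) :
    multiplier m f (k * M) x = multiplier m f k x ^ M := by
  induction M with
  | zero => simp [multiplier]
  | succ M ih => rw [Nat.mul_succ, multiplier_add, ih, (h.mul_const M).eq, pow_succ]

/-- To first order, iterates of `polyMap m f` scale differences lying in a square-zero kernel by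
the multiplier. -/
theorem iterate_polyMap_sub_iterate {a b : ℕ} (φ : ZMod a →+* ZMod b)
    (hφ : ∀ e, φ e = 0 → e ^ 2 = 0) (f : Polynomial ℤ) {x y : ZMod a} (h : φ x = φ y) (j : ℕ) :
    (polyMap a f)^[j] x - (polyMap a f)^[j] y = multiplier a f j y * (x - y) := by
  induction j with
  | zero => simp [multiplier]
  | succ j ih =>
    have hsq : ((polyMap a f)^[j] x - (polyMap a f)^[j] y) ^ 2 = 0 := by
      apply hφ
      rw [map_sub, ((semiconj_polyMap φ f).iterate_right j).eq,
        ((semiconj_polyMap φ f).iterate_right j).eq, h, sub_self]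
    have key := f.aeval_add_of_sq_eq_zero ((polyMap a f)^[j] y) _ hsq
    rw [add_sub_cancel] at key
    rw [Function.iterate_succ_apply', Function.iterate_succ_apply', polyMap, polyMap, key,
      add_sub_cancel_left, ih, multiplier, multiplier, Finset.prod_range_succ]
    ring

theorem sq_eq_zero_of_castHom_eq_zero (p : ℕ) {n : ℕ} (hn : n ≠ 0) (e : ZMod (p ^ (n + 1)))
    (he : ZMod.castHom (pow_dvd_pow p (Nat.le_succ n)) (ZMod (p ^ n)) e = 0) : e ^ 2 = 0 := by
  obtain ⟨z, rfl⟩ := ZMod.intCast_surjective e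
  rw [map_intCast, ZMod.intCast_zmod_eq_zero_iff_dvd] at he
  rw [← Int.cast_pow, ZMod.intCast_zmod_eq_zero_iff_dvd]
  refine dvd_trans ?_ (pow_dvd_pow_of_dvd he 2)
  push_cast
  rw [← pow_mul]
  exact pow_dvd_pow _ (by lia)

theorem castHom_eq_zero_of_mul_eq_zero {p : ℕ} (hp : p.Prime) {n : ℕ} (hn : n ≠ 0)
    {u e : ZMod (p ^ n)} (he : e ≠ 0) (h : u * e = 0) :
    ZMod.castHom (dvd_pow_self p hn) (ZMod p) u = 0 := by
  obtain ⟨z, rfl⟩ := ZMod.intCast_surjective u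
  obtain ⟨t, rfl⟩ := ZMod.intCast_surjective e
  rw [← Int.cast_mul, ZMod.intCast_zmod_eq_zero_iff_dvd] at h
  rw [Ne, ZMod.intCast_zmod_eq_zero_iff_dvd] at he
  rw [map_intCast, ZMod.intCast_zmod_eq_zero_iff_dvd]
  by_contra hz
  refine he (IsCoprime.dvd_of_dvd_mul_left ?_ h)
  push_cast
  exact (((Nat.prime_iff_prime_int.mp hp).coprime_iff_not_dvd).mpr hz).pow_left

/-- Let `v ∈ ZMod p^n` be a periodic point of `F_{p^n}` of minimal period `k`
and let `w ∈ ZMod p^{n+1}` be a lift of `v` that is a periodic point of `F_{p^{n+1}}` of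
minimal period `k·M` for some `M ≥ 1`. Then `λ̄(w) = λ̄(v)^M` in `ZMod p`; moreover if
`M > 1` then `λ̄(w) = 1`. -/
theorem lifted_multiplier_pow (p : ℕ) (hp : p.Prime) (n : ℕ) (hn : n ≠ 0)
    (f : Polynomial ℤ) (k : ℕ) (v : ZMod (p ^ n))
    (hv : v ∈ Function.periodicPts (polyMap (p ^ n) f))
    (hk : Function.minimalPeriod (polyMap (p ^ n) f) v = k)
    (w : ZMod (p ^ (n + 1)))
    (hw : ZMod.castHom (pow_dvd_pow p (Nat.le_succ n)) (ZMod (p ^ n)) w = v)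
    (hwper : w ∈ Function.periodicPts (polyMap (p ^ (n + 1)) f))
    (M : ℕ) (hM : 1 ≤ M)
    (hwk : Function.minimalPeriod (polyMap (p ^ (n + 1)) f) w = k * M) :
    ZMod.castHom (dvd_pow_self p (Nat.succ_ne_zero n)) (ZMod p)
        (multiplier (p ^ (n + 1)) f (k * M) w) =
      (ZMod.castHom (dvd_pow_self p hn) (ZMod p) (multiplier (p ^ n) f k v)) ^ M ∧
    (1 < M →
      ZMod.castHom (dvd_pow_self p (Nat.succ_ne_zero n)) (ZMod p)
        (multiplier (p ^ (n + 1)) f (k * M) w) = 1) := by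
  have hkper : Function.IsPeriodicPt (polyMap (p ^ n) f) k v :=
    hk ▸ Function.isPeriodicPt_minimalPeriod _ _
  have hwM : Function.IsPeriodicPt (polyMap (p ^ (n + 1)) f) (k * M) w :=
    hwk ▸ Function.isPeriodicPt_minimalPeriod _ _
  have hkpos : 0 < k := hk ▸ Function.minimalPeriod_pos_of_mem_periodicPts hv
  refine ⟨?_, fun hM1 => ?_⟩
  · have hproj : ZMod.castHom (dvd_pow_self p (Nat.succ_ne_zero n)) (ZMod p) w =
        ZMod.castHom (dvd_pow_self p hn) (ZMod p) v := by
      rw [← hw, ← RingHom.comp_apply, ZMod.castHom_comp]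
    rw [map_multiplier, hproj, ← map_multiplier, multiplier_mul_of_isPeriodicPt hkper, map_pow]
  · have hfiber : ZMod.castHom (pow_dvd_pow p (Nat.le_succ n)) (ZMod (p ^ n))
          ((polyMap (p ^ (n + 1)) f)^[k] w) =
        ZMod.castHom (pow_dvd_pow p (Nat.le_succ n)) (ZMod (p ^ n)) w := by
      rw [((semiconj_polyMap _ f).iterate_right k).eq, hw, hkper.eq]
    have hne : (polyMap (p ^ (n + 1)) f)^[k] w - w ≠ 0 := fun h =>
      Function.not_isPeriodicPt_of_pos_of_lt_minimalPeriod hkpos.ne'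
        (hwk ▸ lt_mul_of_one_lt_right hkpos hM1) (sub_eq_zero.mp h)
    have hmul := iterate_polyMap_sub_iterate _ (sq_eq_zero_of_castHom_eq_zero p hn) f hfiber (k * M)
    rw [(hwM.apply_iterate k).eq, hwM.eq] at hmul
    have hzero := castHom_eq_zero_of_mul_eq_zero hp (Nat.succ_ne_zero n)
      (u := multiplier (p ^ (n + 1)) f (k * M) w - 1) hne
      (by rw [sub_mul, one_mul, ← hmul, sub_self])
    rwa [map_sub, map_one, sub_eq_zero] at hzero
end

section
/- Let p be a prime, n ≥ 1, f ∈ ℤ[X], and let v ∈ ZMod p^n be a periodic point of F_{p^n} of minimal period k with λ̄(v) = 1 in ZMod p. Then for every integer a with (a mod p^n) = v, one has f^{∘k}(a) ≡ a + r_v·p^n (mod p^{n+1}); in particular the value r_v is unchanged if in its definition the representative a_v is replaced by any other integer representative of v. -/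
/-- `f^{∘k} : ℤ → ℤ`, the `k`-fold iterate of the polynomial map of `f`. -/
noncomputable def polyIter (f : Polynomial ℤ) (k : ℕ) : ℤ → ℤ :=
  (fun x : ℤ => Polynomial.eval x f)^[k]

/-- Iterating the polynomial map on `ZMod m` commutes with reduction of integers. -/
theorem polyMap_iterate_intCast (m : ℕ) (f : Polynomial ℤ) (i : ℕ) (b : ℤ) :
    (polyMap m f)^[i] (b : ZMod m) = (polyIter f i b : ℤ) := by
  have h : Function.Semiconj (fun x : ℤ => (x : ZMod m)) (fun x : ℤ => Polynomial.eval x f)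
      (polyMap m f) := fun x => by
    simpa [polyMap] using
      (Polynomial.aeval_algebraMap_apply (A := ℤ) (ZMod m) x f).symm
  exact (h.iterate_right i b).symm

/-- The multiplier is the reduction of the product of derivatives along an integer orbit. -/
theorem multiplier_intCast (m : ℕ) (f : Polynomial ℤ) (k : ℕ) (b : ℤ) :
    multiplier m f k (b : ZMod m) =
      ((∏ i ∈ Finset.range k, (Polynomial.derivative f).eval (polyIter f i b) : ℤ) : ZMod m) := by
  rw [multiplier, Int.cast_prod]
  refine Finset.prod_congr rfl fun i _ => ?_
  rw [polyMap_iterate_intCast]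
  simpa using
    Polynomial.aeval_algebraMap_apply (A := ℤ) (ZMod m) (polyIter f i b) (Polynomial.derivative f)

/-- First-order expansion of the iterates of a polynomial map modulo `N * q` when `q ∣ N`. -/
theorem polyIter_add_mul_modEq (f : Polynomial ℤ) {q N : ℤ} (hq : q ∣ N) (b t : ℤ) (k : ℕ) :
    polyIter f k (b + N * t) ≡ polyIter f k b + N * t *
      ∏ i ∈ Finset.range k, (Polynomial.derivative f).eval (polyIter f i b) [ZMOD N * q] := by
  induction k with
  | zero => simp [polyIter]
  | succ k ih =>
    have hs (x : ℤ) : polyIter f (k + 1) x = f.eval (polyIter f k x) :=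
      Function.iterate_succ_apply' _ _ _
    rw [hs, hs, Finset.prod_range_succ]
    set P := ∏ i ∈ Finset.range k, (Polynomial.derivative f).eval (polyIter f i b)
    set x := polyIter f k b
    have h1 : f.eval (polyIter f k (b + N * t)) ≡ f.eval (x + N * t * P) [ZMOD N * q] :=
      Int.modEq_iff_dvd.2 (ih.dvd.trans (Polynomial.sub_dvd_eval_sub _ _ f))
    refine h1.trans (Int.modEq_iff_dvd.2 ?_)
    obtain ⟨c, hc⟩ := f.binomExpansion x (N * t * P)
    obtain ⟨d, rfl⟩ := hq
    rw [hc]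
    exact ⟨-(c * d * t ^ 2 * P ^ 2), by ring⟩

/-- Let `v ∈ ZMod p^n` be a periodic point of `F_{p^n}` of minimal period
`k` with `λ̄(v) = 1` in `ZMod p`, and let `r_v ∈ [0, p)` be determined by
`f^{∘k}(a_v) ≡ a_v + r_v·p^n (mod p^{n+1})`, where `a_v ∈ [0, p^n)` represents `v`. Then for
every integer `a` with `a ≡ v`, one has `f^{∘k}(a) ≡ a + r_v·p^n (mod p^{n+1})`; in
particular `r_v` does not depend on the choice of a representative of `v`. -/
theorem r_indep_of_rep (p : ℕ) (hp : p.Prime) (n : ℕ) (hn : n ≠ 0)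
    (f : Polynomial ℤ) (k : ℕ) (v : ZMod (p ^ n))
    (hv : v ∈ Function.periodicPts (polyMap (p ^ n) f))
    (hk : Function.minimalPeriod (polyMap (p ^ n) f) v = k)
    (hlam : ZMod.castHom (dvd_pow_self p hn) (ZMod p) (multiplier (p ^ n) f k v) = 1)
    (r : ℕ) (hrp : r < p)
    (hr : polyIter f k (v.val : ℤ) ≡
      (v.val : ℤ) + (r : ℤ) * (p : ℤ) ^ n [ZMOD (p : ℤ) ^ (n + 1)]) :
    ∀ a : ℤ, (a : ZMod (p ^ n)) = v →
      polyIter f k a ≡ a + (r : ℤ) * (p : ℤ) ^ n [ZMOD (p : ℤ) ^ (n + 1)] := by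
  intro a ha
  have : NeZero (p ^ n) := ⟨pow_ne_zero n hp.ne_zero⟩
  set b : ℤ := (v.val : ℤ)
  have hb : (b : ZMod (p ^ n)) = v := by simp [b]
  obtain ⟨t, ht⟩ : (p : ℤ) ^ n ∣ a - b := by
    have h := (ZMod.intCast_eq_intCast_iff_dvd_sub b a (p ^ n)).1 (hb.trans ha.symm)
    exact_mod_cast h
  obtain rfl : a = b + (p : ℤ) ^ n * t := by linarith
  have hP : (p : ℤ) ∣
      (∏ i ∈ Finset.range k, (Polynomial.derivative f).eval (polyIter f i b)) - 1 := by
    rw [← hb, multiplier_intCast, map_intCast] at hlam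
    rw [← ZMod.intCast_zmod_eq_zero_iff_dvd, Int.cast_sub, hlam]
    simp
  obtain ⟨s, hs⟩ := hP
  have h := polyIter_add_mul_modEq f (dvd_pow_self (p : ℤ) hn) b t k
  rw [← pow_succ] at h
  refine h.trans ((hr.add_right _).trans (Int.modEq_iff_dvd.2 ⟨-(t * s), ?_⟩))
  rw [sub_eq_iff_eq_add.1 hs]
  ring
end

section
/- Let p be a prime, f ∈ ℤ[X], and let v ∈ ZMod p be a periodic point of F_p of minimal period k with λ̄(v) ≠ 0 in ZMod p. Then for every n ≥ 1, every w ∈ ZMod p^n whose image under the projection ZMod p^n → ZMod p lies on the cycle of v is a periodic point of F_{p^n}. -/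
theorem castHom_polyMap {m d : ℕ} (h : d ∣ m) (f : Polynomial ℤ) (x : ZMod m) :
    ZMod.castHom h (ZMod d) (polyMap m f x) = polyMap d f (ZMod.castHom h (ZMod d) x) := by
  simpa [polyMap] using
    (Polynomial.aeval_algHom_apply (ZMod.castHom h (ZMod d)).toIntAlgHom x f).symm

theorem isUnit_of_castHom_ne_zero {p n : ℕ} (hp : p.Prime) (hn : n ≠ 0) {a : ZMod (p ^ n)}
    (ha : ZMod.castHom (dvd_pow_self p hn) (ZMod p) a ≠ 0) : IsUnit a := by
  have : NeZero (p ^ n) := ⟨pow_ne_zero n hp.ne_zero⟩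
  obtain ⟨m, rfl⟩ := ZMod.natCast_zmod_surjective a
  rw [map_natCast, Ne, ZMod.natCast_eq_zero_iff] at ha
  rw [ZMod.isUnit_iff_coprime]
  exact (((Nat.Prime.coprime_iff_not_dvd hp).2 ha).pow_left n).symm

/-- Two points with the same reduction modulo `p` and the same image agree, provided the
derivative does not vanish modulo `p`. -/
theorem eq_of_polyMap_eq {p n : ℕ} (hp : p.Prime) (hn : n ≠ 0) (f : Polynomial ℤ)
    {x y : ZMod (p ^ n)}
    (hxy : ZMod.castHom (dvd_pow_self p hn) (ZMod p) x =
      ZMod.castHom (dvd_pow_self p hn) (ZMod p) y)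
    (hd : polyMap p (Polynomial.derivative f)
      (ZMod.castHom (dvd_pow_self p hn) (ZMod p) x) ≠ 0)
    (h : polyMap (p ^ n) f x = polyMap (p ^ n) f y) : x = y := by
  obtain ⟨c, hc⟩ := Polynomial.binomExpansion
    (f.map (algebraMap ℤ (ZMod (p ^ n)))) x (y - x)
  rw [add_sub_cancel, Polynomial.derivative_map] at hc
  simp only [Polynomial.eval_map_algebraMap] at hc
  have hu : IsUnit (polyMap (p ^ n) (Polynomial.derivative f) x + c * (y - x)) := by
    apply isUnit_of_castHom_ne_zero hp hn
    rwa [map_add, map_mul, map_sub, hxy, sub_self, mul_zero, add_zero, castHom_polyMap]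
  have hz : (polyMap (p ^ n) (Polynomial.derivative f) x + c * (y - x)) * (y - x) = 0 := by
    simp only [polyMap] at h ⊢
    linear_combination -hc - h
  exact (sub_eq_zero.1 ((hu.mul_right_eq_zero).1 hz)).symm

/-- Every point of a finite set mapped injectively into itself is periodic. -/
theorem mem_periodicPts_of_injOn {α : Type*} {g : α → α} {s : Set α} (hs : s.Finite)
    (hg : Set.MapsTo g s s) (hinj : Set.InjOn g s) {x : α} (hx : x ∈ s) :
    x ∈ Function.periodicPts g := by
  have := hs.to_subtype
  obtain ⟨m, hm, h⟩ := Function.Injective.mem_periodicPts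
    (hg.restrict_inj.2 hinj) (⟨x, hx⟩ : s)
  exact ⟨m, hm, by simpa using h.map (g := Subtype.val) (fun _ => rfl)⟩

/-- Let `v ∈ ZMod p` be a periodic point of `F_p` of minimal period `k`
with `λ̄(v) ≠ 0`. Then for every `n ≥ 1`, every `w ∈ ZMod p^n` whose projection to `ZMod p`
lies on the cycle of `v` is a periodic point of `F_{p^n}`. -/
theorem lifts_multiplier_ne_zero_all_periodic (p : ℕ) (hp : p.Prime) (f : Polynomial ℤ)
    (k : ℕ) (v : ZMod p)
    (hv : v ∈ Function.periodicPts (polyMap p f))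
    (hk : Function.minimalPeriod (polyMap p f) v = k)
    (hlam : multiplier p f k v ≠ 0) :
    ∀ n : ℕ, ∀ hn : n ≠ 0, ∀ w : ZMod (p ^ n),
      (∃ i < k, (polyMap p f)^[i] v = ZMod.castHom (dvd_pow_self p hn) (ZMod p) w) →
      w ∈ Function.periodicPts (polyMap (p ^ n) f) := by
  intro n hn w hw
  have : Fact p.Prime := ⟨hp⟩
  have : NeZero (p ^ n) := ⟨pow_ne_zero n hp.ne_zero⟩
  have hk0 : 0 < k := hk ▸ Function.minimalPeriod_pos_of_mem_periodicPts hv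
  have hper (i : ℕ) : (polyMap p f)^[i] v ∈ Function.periodicPts (polyMap p f) :=
    (Function.bijOn_periodicPts (polyMap p f)).mapsTo.iterate i hv
  refine mem_periodicPts_of_injOn (s := {w | ∃ i < k, (polyMap p f)^[i] v =
    ZMod.castHom (dvd_pow_self p hn) (ZMod p) w}) (Set.toFinite _) ?_ ?_ hw
  · rintro x ⟨i, -, hi⟩
    refine ⟨(i + 1) % k, Nat.mod_lt _ hk0, ?_⟩
    rw [← hk, Function.iterate_mod_minimalPeriod_eq, Function.iterate_succ_apply', hi,
      castHom_polyMap]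
  · rintro x ⟨i, hik, hi⟩ y ⟨j, -, hj⟩ hxy
    refine eq_of_polyMap_eq hp hn f ?_ ?_ hxy
    · refine (Function.bijOn_periodicPts (polyMap p f)).injOn (hi ▸ hper i) (hj ▸ hper j) ?_
      rw [← castHom_polyMap, ← castHom_polyMap, hxy]
    · rw [← hi]
      exact Finset.prod_ne_zero_iff.1 hlam i (Finset.mem_range.2 hik)
end
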